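/- Let d ≥ 1 and let F be a degree-d foliation of ℙ²(ℂ) leaving the line at infinity L∞ = (z = 0) invariant, given in the affine chart z = 1 by ω = Σ_{i=0}^{d} (A_i dx + B_i dy) with A_i, B_i ∈ ℂ[x,y] homogeneous of degree i, with xA_d + yB_d ≠ 0 and with the homogeneous coefficients of the associated projective 1-form Ω having no common factor. Assume that every singular point of F lying on L∞ (i.e. every projective zero [x₀:y₀:0] of xA_d + yB_d) is nondegenerate. Then: (a) gcd(A_d, B_d) = 1, so ω_d = A_d dx + B_d dy defines a homogeneous degree-d foliation H of ℙ²(ℂ); (b) L∞ is H-invariant and Sing H ∩ L∞ = Sing F ∩ L∞; (c) every point s ∈ Sing H ∩ L∞ is a nondegenerate singularity of H and CS(H, L∞, s) = CS(F, L∞, s); (d) H belongs to the closure of the PGL₃(ℂ)-orbit of F in the space F(d) of degree-d foliations. -/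

import Mathlib

open MvPolynomial

noncomputable section

/-- The inclusion `ℂ[x,y] → ℂ[x,y,z]`. -/
def emb : MvPolynomial (Fin 2) ℂ →ₐ[ℂ] MvPolynomial (Fin 3) ℂ :=
  rename Fin.castSucc

/-- The homogeneous projective 1-form
`Ω = (zA − yC) dx + (zB + xC) dy − (xA + yB) dz`
associated to the affine 1-form `ω = A dx + B dy + C (x dy − y dx)` of a degree-3
foliation with a singular point of algebraic multiplicity 3 at the origin
(`A`, `B`, `C` homogeneous of degree 3). -/
def OmABC (A B Cc : MvPolynomial (Fin 2) ℂ) : Fin 3 → MvPolynomial (Fin 3) ℂ :=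
  ![X 2 * emb A - X 1 * emb Cc,
    X 2 * emb B + X 0 * emb Cc,
    -(X 0 * emb A + X 1 * emb B)]

/-- Substitution of the linear change of variables on `ℂ³` given by the matrix `M`. -/
def subst3 (M : Matrix (Fin 3) (Fin 3) ℂ) (P : MvPolynomial (Fin 3) ℂ) :
    MvPolynomial (Fin 3) ℂ :=
  aeval (fun i => ∑ j, C (M i j) * X j) P

/-- Pullback of the 1-form with coefficient vector `Ω` by the linear map of matrix `M`. -/
def pb3 (M : Matrix (Fin 3) (Fin 3) ℂ) (Ω : Fin 3 → MvPolynomial (Fin 3) ℂ) :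
    Fin 3 → MvPolynomial (Fin 3) ℂ :=
  fun i => ∑ j, C (M j i) * subst3 M (Ω j)

/-- Two projective 1-forms are linearly conjugate: `T*Ω = c·Ω'` for some
`T ∈ GL₃(ℂ)` and `c ∈ ℂ*`. -/
def LinConj3 (Ω Ω' : Fin 3 → MvPolynomial (Fin 3) ℂ) : Prop :=
  ∃ (M : Matrix (Fin 3) (Fin 3) ℂ) (c : ℂ), IsUnit M.det ∧ c ≠ 0 ∧
    pb3 M Ω = fun i => C c * Ω' i

/-- Dehomogenization in the chart `y = 1` (chart coordinates `(x, z)`). -/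
def dhy : MvPolynomial (Fin 3) ℂ →ₐ[ℂ] MvPolynomial (Fin 2) ℂ :=
  aeval (![X 0, 1, X 1] : Fin 3 → MvPolynomial (Fin 2) ℂ)

/-- Dehomogenization in the chart `x = 1` (chart coordinates `(y, z)`). -/
def dhx : MvPolynomial (Fin 3) ℂ →ₐ[ℂ] MvPolynomial (Fin 2) ℂ :=
  aeval (![1, X 0, X 1] : Fin 3 → MvPolynomial (Fin 2) ℂ)

/-- The orbit of the 1-form `Ω` under pullback by `GL₃(ℂ)` and nonzero rescaling. -/
def OrbitOf (Ω : Fin 3 → MvPolynomial (Fin 3) ℂ) :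
    Set (Fin 3 → MvPolynomial (Fin 3) ℂ) :=
  {Ω' | ∃ (M : Matrix (Fin 3) (Fin 3) ℂ) (c : ℂ), IsUnit M.det ∧ c ≠ 0 ∧
    pb3 M Ω = fun i => C c * Ω' i}

/-- `Ω` defines a degree-`d` foliation of `ℙ²(ℂ)`: it is a nonzero 1-form with
homogeneous coefficients of degree `d + 1` annihilating the radial vector field and
with no common factor. -/
def IsFolDeg (d : ℕ) (Ω : Fin 3 → MvPolynomial (Fin 3) ℂ) : Prop :=
  Ω ≠ 0 ∧ (∀ i, (Ω i).IsHomogeneous (d + 1)) ∧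
    X 0 * Ω 0 + X 1 * Ω 1 + X 2 * Ω 2 = 0 ∧
    ∀ h : MvPolynomial (Fin 3) ℂ, (∀ i, h ∣ Ω i) → IsUnit h

/-- The coefficient vector of a triple of polynomials. -/
def coeffs (Ω : Fin 3 → MvPolynomial (Fin 3) ℂ) : Fin 3 → (Fin 3 →₀ ℕ) → ℂ :=
  fun i m => coeff m (Ω i)

/-- Closure, inside the space `F(d)` of degree-`d` foliations with its classical
topology (read off on the coefficients), of a set of defining 1-forms. -/
def FClos (d : ℕ) (S : Set (Fin 3 → MvPolynomial (Fin 3) ℂ)) :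
    Set (Fin 3 → MvPolynomial (Fin 3) ℂ) :=
  {Ω' | IsFolDeg d Ω' ∧ coeffs Ω' ∈ closure (coeffs '' S)}

/-- Homogenization to degree `d` in `ℂ[x,y,z]` of `∑_{i ≤ d} A_i ∈ ℂ[x,y]`,
`A_i` homogeneous of degree `i`. -/
def AhomF (d : ℕ) (A : ℕ → MvPolynomial (Fin 2) ℂ) : MvPolynomial (Fin 3) ℂ :=
  ∑ i ∈ Finset.range (d + 1), X 2 ^ (d - i) * rename Fin.castSucc (A i)

/-- The projective 1-form of the degree-`d` foliation given in the chart `z = 1` by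
`ω = ∑ (A_i dx + B_i dy)`: `Ω = zA dx + zB dy − (xA + yB) dz`. -/
def OmegaAff (d : ℕ) (A B : ℕ → MvPolynomial (Fin 2) ℂ) :
    Fin 3 → MvPolynomial (Fin 3) ℂ :=
  ![X 2 * AhomF d A, X 2 * AhomF d B, -(X 0 * AhomF d A + X 1 * AhomF d B)]

/-- The projective 1-form of the homogeneous foliation `ω_d = A_d dx + B_d dy`. -/
def OmegaHom (Ad Bd : MvPolynomial (Fin 2) ℂ) : Fin 3 → MvPolynomial (Fin 3) ℂ :=
  ![X 2 * rename Fin.castSucc Ad, X 2 * rename Fin.castSucc Bd,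
    -(X 0 * rename Fin.castSucc Ad + X 1 * rename Fin.castSucc Bd)]

/-- The point `[x₀ : 1 : 0]` is a singular point: in the chart `y = 1` the 1-form
`θ = p̃ dx + r̃ dz` vanishes at `(x₀, 0)`. -/
def singY (Ω : Fin 3 → MvPolynomial (Fin 3) ℂ) (x₀ : ℂ) : Prop :=
  eval ![x₀, 0] (dhy (Ω 0)) = 0 ∧ eval ![x₀, 0] (dhy (Ω 2)) = 0

/-- The point `[1 : 0 : 0]` is a singular point (chart `x = 1`). -/
def singX (Ω : Fin 3 → MvPolynomial (Fin 3) ℂ) : Prop :=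
  eval (![0, 0] : Fin 2 → ℂ) (dhx (Ω 1)) = 0 ∧
    eval (![0, 0] : Fin 2 → ℂ) (dhx (Ω 2)) = 0

/-- Nondegeneracy at `[x₀ : 1 : 0]`: the Jacobian determinant of the chart vector
field `X = (−r̃, p̃)` at `(x₀, 0)` is nonzero. -/
def ndY (Ω : Fin 3 → MvPolynomial (Fin 3) ℂ) (x₀ : ℂ) : Prop :=
  eval ![x₀, 0] (pderiv 0 (-(dhy (Ω 2))) * pderiv 1 (dhy (Ω 0)) -
    pderiv 1 (-(dhy (Ω 2))) * pderiv 0 (dhy (Ω 0))) ≠ 0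

/-- Nondegeneracy at `[1 : 0 : 0]` (chart `x = 1`). -/
def ndX (Ω : Fin 3 → MvPolynomial (Fin 3) ℂ) : Prop :=
  eval (![0, 0] : Fin 2 → ℂ) (pderiv 0 (-(dhx (Ω 2))) * pderiv 1 (dhx (Ω 1)) -
    pderiv 1 (-(dhx (Ω 2))) * pderiv 0 (dhx (Ω 1))) ≠ 0

/-- The Camacho–Sad index, along the line at infinity `z = 0`, at the singular point
`[x₀ : 1 : 0]`: the ratio of the eigenvalue of the chart vector field along the line
by the transverse eigenvalue. -/
def csY (Ω : Fin 3 → MvPolynomial (Fin 3) ℂ) (x₀ : ℂ) : ℂ :=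
  eval ![x₀, 0] (pderiv 0 (-(dhy (Ω 2)))) / eval ![x₀, 0] (pderiv 1 (dhy (Ω 0)))

/-- The Camacho–Sad index along `z = 0` at `[1 : 0 : 0]`. -/
def csX (Ω : Fin 3 → MvPolynomial (Fin 3) ℂ) : ℂ :=
  eval (![0, 0] : Fin 2 → ℂ) (pderiv 0 (-(dhx (Ω 2)))) /
    eval (![0, 0] : Fin 2 → ℂ) (pderiv 1 (dhx (Ω 1)))

theorem aux_unit {σ : Type*} [Finite σ] (i j : σ) (hij : i ≠ j) (h : MvPolynomial σ ℂ)
    (hz : ∀ v : σ → ℂ, eval v h = 0 → v i = 0 ∧ v j = 0) : IsUnit h := by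
  have key : ∀ l : σ, (∀ v : σ → ℂ, eval v h = 0 → v l = 0) → ∃ n : ℕ, h ∣ X l ^ n := by
    intro l hl
    have h1 : (X l : MvPolynomial σ ℂ) ∈
        vanishingIdeal ℂ (zeroLocus ℂ (Ideal.span {h})) := by
      intro v hv
      have := hv h (Ideal.subset_span rfl)
      rw [MvPolynomial.aeval_eq_eval] at this
      simpa using hl v this
    rw [vanishingIdeal_zeroLocus_eq_radical] at h1
    obtain ⟨n, hn⟩ := h1
    exact ⟨n, Ideal.mem_span_singleton.1 hn⟩
  obtain ⟨n, hn⟩ := key i (fun v hv => (hz v hv).1)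
  obtain ⟨m, hm⟩ := key j (fun v hv => (hz v hv).2)
  have hrel : IsRelPrime (X i : MvPolynomial σ ℂ) (X j) := by
    rw [(X_prime (R := ℂ) (i := i)).irreducible.isRelPrime_iff_not_dvd]
    intro hd
    rw [X_dvd_X] at hd
    exact hij hd
  exact (hrel.pow_left (m := n)).pow_right (n := m) hn hm

theorem aux_scale {n : ℕ} {φ : MvPolynomial (Fin 2) ℂ} (h : φ.IsHomogeneous n)
    (c : ℂ) (v : Fin 2 → ℂ) : eval (fun i => c * v i) φ = c ^ n * eval v φ := by
  rw [eval_eq, eval_eq, Finset.mul_sum]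
  refine Finset.sum_congr rfl fun s hs => ?_
  rw [h.degree_eq_sum_deg_support hs]
  simp only [mul_pow, Finset.prod_mul_distrib, Finset.prod_pow_eq_pow_sum]
  ring

def FF (P Q : MvPolynomial (Fin 3) ℂ) : Fin 3 → MvPolynomial (Fin 3) ℂ :=
  ![X 2 * P, X 2 * Q, -(X 0 * P + X 1 * Q)]

theorem aux_split (d : ℕ) (A : ℕ → MvPolynomial (Fin 2) ℂ) :
    ∃ R, AhomF d A = rename Fin.castSucc (A d) + X 2 * R := by
  refine ⟨∑ i ∈ Finset.range d, X 2 ^ (d - i - 1) * rename Fin.castSucc (A i), ?_⟩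
  rw [AhomF, Finset.sum_range_succ, Finset.mul_sum, add_comm]
  congr 1
  · simp
  · refine Finset.sum_congr rfl fun i hi => ?_
    have : d - i = (d - i - 1) + 1 := by
      have := Finset.mem_range.1 hi
      omega
    rw [← mul_assoc, ← pow_succ', ← this]

theorem evY (x₀ : ℂ) (a : MvPolynomial (Fin 2) ℂ) :
    eval ![x₀, 0] (dhy (rename Fin.castSucc a)) = eval ![x₀, 1] a := by
  induction a using MvPolynomial.induction_on with
  | C a => simp
  | add p q hp hq => simp [hp, hq]
  | mul_X p i hp => 
    simp only [map_mul, hp, rename_X]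
    fin_cases i <;> simp [dhy]

theorem evX (a : MvPolynomial (Fin 2) ℂ) :
    eval ![0, 0] (dhx (rename Fin.castSucc a)) = eval ![1, 0] a := by
  induction a using MvPolynomial.induction_on with
  | C a => simp
  | add p q hp hq => simp [hp, hq]
  | mul_X p i hp => 
    simp only [map_mul, hp, rename_X]
    fin_cases i <;> simp [dhx]

theorem dhy_X0 : dhy (X 0) = X 0 := by simp [dhy]
theorem dhy_X1 : dhy (X 1) = 1 := by simp [dhy]
theorem dhy_X2 : dhy (X 2) = X 1 := by simp [dhy]
theorem dhx_X0 : dhx (X 0) = 1 := by simp [dhx]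
theorem dhx_X1 : dhx (X 1) = X 0 := by simp [dhx]
theorem dhx_X2 : dhx (X 2) = X 1 := by simp [dhx]

theorem singY_FF (P Q R S : MvPolynomial (Fin 3) ℂ) (x₀ : ℂ) :
    singY (FF (P + X 2 * R) (Q + X 2 * S)) x₀ ↔
      x₀ * eval ![x₀, 0] (dhy P) + eval ![x₀, 0] (dhy Q) = 0 := by
  simp [singY, FF, dhy_X0, dhy_X1, dhy_X2, ← neg_add, neg_eq_zero, -neg_add_rev]

theorem singX_FF (P Q R S : MvPolynomial (Fin 3) ℂ) :
    singX (FF (P + X 2 * R) (Q + X 2 * S)) ↔ eval ![0, 0] (dhx P) = 0 := by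
  simp [singX, FF, dhx_X0, dhx_X1, dhx_X2]

def dY (P Q : MvPolynomial (Fin 3) ℂ) (x₀ : ℂ) : ℂ :=
  eval ![x₀, 0] (pderiv 0 (X 0 * dhy P + dhy Q))

def dX (P Q : MvPolynomial (Fin 3) ℂ) : ℂ :=
  eval ![0, 0] (pderiv 0 (dhx P + X 0 * dhx Q))

theorem ndY_FF (P Q R S : MvPolynomial (Fin 3) ℂ) (x₀ : ℂ) :
    ndY (FF (P + X 2 * R) (Q + X 2 * S)) x₀ ↔
      dY P Q x₀ * eval ![x₀, 0] (dhy P) ≠ 0 := by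
  simp [ndY, FF, dY, dhy_X0, dhy_X1, dhy_X2, pderiv_X]

theorem csY_FF (P Q R S : MvPolynomial (Fin 3) ℂ) (x₀ : ℂ) :
    csY (FF (P + X 2 * R) (Q + X 2 * S)) x₀ =
      dY P Q x₀ / eval ![x₀, 0] (dhy P) := by
  simp [csY, FF, dY, dhy_X0, dhy_X1, dhy_X2, pderiv_X]

theorem ndX_FF (P Q R S : MvPolynomial (Fin 3) ℂ) :
    ndX (FF (P + X 2 * R) (Q + X 2 * S)) ↔
      dX P Q * eval ![0, 0] (dhx Q) ≠ 0 := by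
  simp [ndX, FF, dX, dhx_X0, dhx_X1, dhx_X2, pderiv_X]

theorem csX_FF (P Q R S : MvPolynomial (Fin 3) ℂ) :
    csX (FF (P + X 2 * R) (Q + X 2 * S)) =
      dX P Q / eval ![0, 0] (dhx Q) := by
  simp [csX, FF, dX, dhx_X0, dhx_X1, dhx_X2, pderiv_X]

theorem cont_coeff_mul {f g : ℂ → MvPolynomial (Fin 3) ℂ}
    (hf : ∀ m, Continuous fun t => coeff m (f t)) (hg : ∀ m, Continuous fun t => coeff m (g t)) :
    ∀ m, Continuous fun t => coeff m (f t * g t) := by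
  intro m
  simp only [coeff_mul]
  exact continuous_finsetSum _ fun p _ => (hf _).mul (hg _)

def tw (d : ℕ) (t : ℂ) (A : ℕ → MvPolynomial (Fin 2) ℂ) : ℕ → MvPolynomial (Fin 2) ℂ :=
  fun i => C (t ^ (d - i)) * A i

theorem cont_Ahom (d : ℕ) (A : ℕ → MvPolynomial (Fin 2) ℂ) (m : Fin 3 →₀ ℕ) :
    Continuous fun t => coeff m (AhomF d (tw d t A)) := by
  simp only [AhomF, tw, coeff_sum, map_mul, rename_C]
  refine continuous_finsetSum _ fun i _ => ?_
  have : ∀ t : ℂ, X 2 ^ (d - i) * (C (t ^ (d - i)) * rename Fin.castSucc (A i)) =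
      C (t ^ (d - i)) * (X 2 ^ (d - i) * rename Fin.castSucc (A i)) := fun t => by ring
  simp only [this, coeff_C_mul]
  fun_prop

theorem Ahom_zero (d : ℕ) (A : ℕ → MvPolynomial (Fin 2) ℂ) :
    AhomF d (tw d 0 A) = rename Fin.castSucc (A d) := by
  rw [AhomF, Finset.sum_range_succ, Finset.sum_eq_zero]
  · simp [tw]
  · intro i hi
    have : d - i ≠ 0 := by
      have := Finset.mem_range.1 hi
      omega
    simp [tw, this]

theorem subst3_diag_rename (t : ℂ) (a : MvPolynomial (Fin 2) ℂ) :
    subst3 (Matrix.diagonal ![1, 1, t]) (rename Fin.castSucc a) = rename Fin.castSucc a := by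
  rw [subst3, aeval_rename]
  conv_rhs => rw [rename_eq_aeval]
  congr 2
  funext i
  fin_cases i <;> simp [Fin.sum_univ_three, Matrix.diagonal]

theorem subst3_diag_Ahom (t : ℂ) (d : ℕ) (A : ℕ → MvPolynomial (Fin 2) ℂ) :
    subst3 (Matrix.diagonal ![1, 1, t]) (AhomF d A) = AhomF d (tw d t A) := by
  have h2 : subst3 (Matrix.diagonal ![1, 1, t]) (X 2) = C t * X 2 := by
    simp [subst3, Fin.sum_univ_three, Matrix.diagonal]
  have h3 := subst3_diag_rename t
  simp only [subst3] at h2 h3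
  simp only [subst3, AhomF, map_sum, map_mul, map_pow, h2, h3, tw, rename_C]
  refine Finset.sum_congr rfl fun i _ => ?_
  ring

theorem pb3_diag (t : ℂ) (d : ℕ) (A B : ℕ → MvPolynomial (Fin 2) ℂ) :
    pb3 (Matrix.diagonal ![1, 1, t]) (OmegaAff d A B) =
      fun i => C t * OmegaAff d (tw d t A) (tw d t B) i := by
  have hA := subst3_diag_Ahom t d A
  have hB := subst3_diag_Ahom t d B
  have h2 : subst3 (Matrix.diagonal ![1, 1, t]) (X 2) = C t * X 2 := by
    simp [subst3, Fin.sum_univ_three, Matrix.diagonal]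
  have h1 : subst3 (Matrix.diagonal ![1, 1, t]) (X 1) = X 1 := by
    simp [subst3, Fin.sum_univ_three, Matrix.diagonal]
  have h0 : subst3 (Matrix.diagonal ![1, 1, t]) (X 0) = X 0 := by
    simp [subst3, Fin.sum_univ_three, Matrix.diagonal]
  have hm : ∀ M p q, subst3 M (p * q) = subst3 M p * subst3 M q := fun M p q => map_mul _ _ _
  have ha : ∀ M p q, subst3 M (p + q) = subst3 M p + subst3 M q := fun M p q => map_add _ _ _
  have hn : ∀ M p, subst3 M (-p) = - subst3 M p := fun M p => map_neg _ _
  funext i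
  simp only [pb3, OmegaAff, Fin.sum_univ_three, Matrix.cons_val, hm, ha, hn, hA, hB, h0, h1, h2]
  fin_cases i <;> simp [Matrix.diagonal] <;> ring

theorem mem_clos (d : ℕ) (A B : ℕ → MvPolynomial (Fin 2) ℂ) :
    coeffs (OmegaHom (A d) (B d)) ∈ closure (coeffs '' OrbitOf (OmegaAff d A B)) := by
  have hc : Continuous fun t : ℂ => coeffs (OmegaAff d (tw d t A) (tw d t B)) := by
    refine continuous_pi fun i => continuous_pi fun m => ?_
    have hX : ∀ (P : MvPolynomial (Fin 3) ℂ), ∀ m, Continuous fun _ : ℂ => coeff m P :=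
      fun P m => continuous_const
    have hA := cont_Ahom d A
    have hB := cont_Ahom d B
    fin_cases i
    · exact cont_coeff_mul (hX (X 2)) hA m
    · exact cont_coeff_mul (hX (X 2)) hB m
    · have := ((cont_coeff_mul (hX (X 0)) hA m).add (cont_coeff_mul (hX (X 1)) hB m)).neg
      convert this using 2
      simp only [_root_.coeffs, OmegaAff]
      simp [add_comm]
  have h0 : OmegaAff d (tw d 0 A) (tw d 0 B) = OmegaHom (A d) (B d) := by
    simp only [OmegaAff, OmegaHom, Ahom_zero]
  have ht : Filter.Tendsto (fun t : ℂ => coeffs (OmegaAff d (tw d t A) (tw d t B)))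
      (nhdsWithin 0 {0}ᶜ) (nhds (coeffs (OmegaHom (A d) (B d)))) := by
    rw [← h0]
    exact (hc.tendsto 0).mono_left nhdsWithin_le_nhds
  refine mem_closure_of_tendsto ht ?_
  filter_upwards [self_mem_nhdsWithin] with t htn
  have htn : t ≠ 0 := htn
  refine ⟨_, ⟨Matrix.diagonal ![1, 1, t], t, ?_, htn, pb3_diag t d A B⟩, rfl⟩
  simp [Matrix.det_diagonal, Fin.prod_univ_three, htn]

theorem proj_z (a : MvPolynomial (Fin 2) ℂ) :
    aeval (![X 0, X 1, 0] : Fin 3 → MvPolynomial (Fin 2) ℂ) (rename Fin.castSucc a) = a := by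
  rw [aeval_rename]
  conv_rhs => rw [← aeval_X_left_apply a]
  congr 2
  funext i
  fin_cases i <;> simp

theorem isFol (d : ℕ) (a b : MvPolynomial (Fin 2) ℂ) (ha : a.IsHomogeneous d)
    (hb : b.IsHomogeneous d) (hcone : X 0 * a + X 1 * b ≠ 0)
    (hz : ∀ v : Fin 2 → ℂ, eval v a = 0 → eval v b = 0 → v = 0) :
    IsFolDeg d (OmegaHom a b) := by
  have hnd : ¬ (X 2 : MvPolynomial (Fin 3) ℂ) ∣ OmegaHom a b 2 := by
    rintro ⟨q, hq⟩
    have := congrArg (aeval (![X 0, X 1, 0] : Fin 3 → MvPolynomial (Fin 2) ℂ)) hq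
    simp only [OmegaHom, Matrix.cons_val, map_neg, map_add, map_mul, proj_z, aeval_X] at this
    apply hcone
    rw [zero_mul, neg_eq_zero] at this
    simpa using this
  refine ⟨?_, ?_, ?_, ?_⟩
  · intro h
    apply hnd
    rw [h]
    exact dvd_zero _
  · have ha' := ha.rename_isHomogeneous (f := Fin.castSucc)
    have hb' := hb.rename_isHomogeneous (f := Fin.castSucc)
    intro i
    rw [add_comm]
    fin_cases i
    · exact (isHomogeneous_X _ _).mul ha'
    · exact (isHomogeneous_X _ _).mul hb'
    · exact (((isHomogeneous_X _ _).mul ha').add ((isHomogeneous_X _ _).mul hb')).neg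
  · simp [OmegaHom]
    ring
  · intro h hh
    have hrel : IsRelPrime h (X 2) := by
      apply IsRelPrime.symm
      rw [(X_prime (R := ℂ) (i := (2 : Fin 3))).irreducible.isRelPrime_iff_not_dvd]
      exact fun hd => hnd (hd.trans (hh 2))
    have h0 : h ∣ rename Fin.castSucc a := hrel.dvd_of_dvd_mul_left (hh 0)
    have h1 : h ∣ rename Fin.castSucc b := hrel.dvd_of_dvd_mul_left (hh 1)
    refine aux_unit 0 1 (by decide) h fun v hv => ?_
    have e : ∀ p : MvPolynomial (Fin 2) ℂ, h ∣ rename Fin.castSucc p →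
        eval (v ∘ Fin.castSucc) p = 0 := by
      rintro p ⟨q, hq⟩
      rw [← eval_rename, hq, map_mul, hv, zero_mul]
    have := hz _ (e a h0) (e b h1)
    exact ⟨congrFun this 0, congrFun this 1⟩

/-- **Degeneration of a foliation with invariant line onto a homogeneous one.**
Let `d ≥ 1` and let `F` be a degree-`d` foliation leaving the line at infinity
invariant, given in the chart `z = 1` by `ω = ∑_{i≤d} (A_i dx + B_i dy)` with `A_i, B_i`
homogeneous of degree `i`, `xA_d + yB_d ≠ 0`, and with the coefficients of the
associated projective 1-form having no common factor.  If every singular point of `F`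
on the line at infinity is nondegenerate, then, `H` denoting the homogeneous foliation
defined by `ω_d = A_d dx + B_d dy`:
(a) `gcd(A_d, B_d) = 1` (so `H` is a well-defined homogeneous degree-`d` foliation);
(b) the line at infinity is `H`-invariant and `Sing H ∩ L∞ = Sing F ∩ L∞`;
(c) every `s ∈ Sing H ∩ L∞` is a nondegenerate singularity of `H` with
    `CS(H, L∞, s) = CS(F, L∞, s)`;
(d) `H` lies in the closure of the `PGL₃(ℂ)`-orbit of `F` in `F(d)`. -/
theorem stmt_9 (d : ℕ) (hd : 1 ≤ d) (A B : ℕ → MvPolynomial (Fin 2) ℂ)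
    (hhom : ∀ i ≤ d, (A i).IsHomogeneous i ∧ (B i).IsHomogeneous i)
    (hcone : X 0 * A d + X 1 * B d ≠ 0)
    (hgcd : ∀ h : MvPolynomial (Fin 3) ℂ,
      (∀ i, h ∣ OmegaAff d A B i) → IsUnit h)
    (hndY : ∀ x₀ : ℂ, singY (OmegaAff d A B) x₀ → ndY (OmegaAff d A B) x₀)
    (hndX : singX (OmegaAff d A B) → ndX (OmegaAff d A B)) :
    (∀ h : MvPolynomial (Fin 2) ℂ, h ∣ A d → h ∣ B d → IsUnit h) ∧
    (X 2 ∣ OmegaHom (A d) (B d) 0 ∧ X 2 ∣ OmegaHom (A d) (B d) 1) ∧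
    (∀ x₀ : ℂ, singY (OmegaHom (A d) (B d)) x₀ ↔ singY (OmegaAff d A B) x₀) ∧
    (singX (OmegaHom (A d) (B d)) ↔ singX (OmegaAff d A B)) ∧
    (∀ x₀ : ℂ, singY (OmegaHom (A d) (B d)) x₀ →
      ndY (OmegaHom (A d) (B d)) x₀ ∧
        csY (OmegaHom (A d) (B d)) x₀ = csY (OmegaAff d A B) x₀) ∧
    (singX (OmegaHom (A d) (B d)) →
      ndX (OmegaHom (A d) (B d)) ∧ csX (OmegaHom (A d) (B d)) = csX (OmegaAff d A B)) ∧
    OmegaHom (A d) (B d) ∈ FClos d (OrbitOf (OmegaAff d A B)) := by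
  obtain ⟨R, hR⟩ := aux_split d A
  obtain ⟨S, hS⟩ := aux_split d B
  have hF : OmegaAff d A B = FF (rename Fin.castSucc (A d) + X 2 * R)
      (rename Fin.castSucc (B d) + X 2 * S) := by
    rw [← hR, ← hS]; rfl
  have hH : OmegaHom (A d) (B d) = FF (rename Fin.castSucc (A d) + X 2 * 0)
      (rename Fin.castSucc (B d) + X 2 * 0) := by
    simp only [mul_zero, add_zero]; rfl
  have hA := (hhom d le_rfl).1
  have hB := (hhom d le_rfl).2
  have hz : ∀ v : Fin 2 → ℂ, eval v (A d) = 0 → eval v (B d) = 0 → v = 0 := by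
    intro v hva hvb
    by_contra hv
    by_cases h1 : v 1 = 0
    · have h0 : v 0 ≠ 0 := by
        intro h0
        apply hv
        funext i
        fin_cases i <;> simp [h0, h1]
      have hvv : (fun i => (v 0)⁻¹ * v i) = ![1, 0] := by
        funext i
        fin_cases i <;> simp [h0, h1]
      have ea := aux_scale hA (v 0)⁻¹ v
      have eb := aux_scale hB (v 0)⁻¹ v
      rw [hvv, hva, mul_zero] at ea
      rw [hvv, hvb, mul_zero] at eb
      rw [hF, singX_FF, ndX_FF, evX, evX] at hndX
      exact hndX ea (by rw [eb, mul_zero])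
    · have hvv : (fun i => (v 1)⁻¹ * v i) = ![(v 1)⁻¹ * v 0, 1] := by
        funext i
        fin_cases i <;> simp [h1]
      have ea := aux_scale hA (v 1)⁻¹ v
      have eb := aux_scale hB (v 1)⁻¹ v
      rw [hvv, hva, mul_zero] at ea
      rw [hvv, hvb, mul_zero] at eb
      have := hndY ((v 1)⁻¹ * v 0)
      rw [hF, singY_FF, ndY_FF, evY, evY] at this
      exact this (by rw [ea, eb]; ring) (by rw [ea, mul_zero])
  refine ⟨?_, ⟨dvd_mul_right _ _, dvd_mul_right _ _⟩, ?_, ?_, ?_, ?_,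
    isFol d _ _ hA hB hcone hz, mem_clos d A B⟩
  · rintro h ⟨p, hp⟩ ⟨q, hq⟩
    refine aux_unit 0 1 (by decide) h fun v hv => ?_
    have := hz v (by rw [hp, map_mul, hv, zero_mul]) (by rw [hq, map_mul, hv, zero_mul])
    exact ⟨congrFun this 0, congrFun this 1⟩
  · intro x₀
    rw [hF, hH, singY_FF, singY_FF]
  · rw [hF, hH, singX_FF, singX_FF]
  · intro x₀ hs
    have := hndY x₀
    rw [hF, singY_FF, ndY_FF] at this
    rw [hH, singY_FF] at hs
    rw [hF, hH, ndY_FF, csY_FF, csY_FF]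
    exact ⟨this hs, rfl⟩
  · intro hs
    rw [hF, singX_FF, ndX_FF] at hndX
    rw [hH, singX_FF] at hs
    rw [hF, hH, ndX_FF, csX_FF, csX_FF]
    exact ⟨hndX hs, rfl⟩
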